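/- Fix the parameter m = 1000 in the definition of H_n. Then: (i) for all sufficiently large n, π(G_n) < π(H_n); and (ii) τ_{1/2}(G_n)/τ_{1/2}(H_n) → ∞ as n → ∞, i.e. for every constant c > 0 one has τ_{1/2}(G_n) > c·τ_{1/2}(H_n) for all sufficiently large n. In particular τ_{1/2}(G_n) ∉ O(τ_{1/2}(H_n)), disproving the conjecture of Hurlbert et al. that π(G_n) ≤ π(H_n) for all n implies τ_α(G_n) ∈ O(τ_α(H_n)). -/

import Mathlib

open Finset

/-- A single pebbling move on `G`: remove two pebbles from a vertex `u` with at least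
two pebbles and add one pebble to a vertex `v` adjacent to `u`. -/
def PebblingMove {V : Type*} [DecidableEq V] (G : SimpleGraph V) (C C' : V → ℕ) : Prop :=
  ∃ u v : V, G.Adj u v ∧ 2 ≤ C u ∧
    C' = fun w => if w = u then C u - 2 else if w = v then C v + 1 else C w

/-- A configuration is solvable if every vertex can receive a pebble after finitely
many pebbling moves. -/
def Solvable {V : Type*} [DecidableEq V] (G : SimpleGraph V) (C : V → ℕ) : Prop :=
  ∀ v : V, ∃ C' : V → ℕ, Relation.ReflTransGen (PebblingMove G) C C' ∧ 1 ≤ C' v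

/-- The pebbling number `π(G)`: the least `t` such that every configuration of size `t`
is solvable. -/
noncomputable def pebblingNumber {V : Type*} [Fintype V] [DecidableEq V]
    (G : SimpleGraph V) : ℕ :=
  sInf {t : ℕ | ∀ C : V → ℕ, (∑ v, C v) = t → Solvable G C}

/-- The finset of all configurations of `t` pebbles on `n` vertices. -/
def configs (n t : ℕ) : Finset (Fin n → ℕ) :=
  (Fintype.piFinset fun _ : Fin n => Finset.range (t + 1)).filter fun C => ∑ i, C i = t

open scoped Classical in
/-- `P(G; t)`: the proportion of solvable configurations among all `C(n+t-1, t)`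
configurations of size `t`. -/
noncomputable def solvableProportion (n : ℕ) (G : SimpleGraph (Fin n)) (t : ℕ) : ℝ :=
  (((configs n t).filter fun C => Solvable G C).card : ℝ) / (Nat.choose (n + t - 1) t : ℝ)

/-- `τ_α(G)`: the least `t` with `P(G;t) ≥ α`. -/
noncomputable def tauAlpha (n : ℕ) (G : SimpleGraph (Fin n)) (α : ℝ) : ℕ :=
  sInf {t : ℕ | α ≤ solvableProportion n G t}

/-- A path on vertices `0, …, L-1` whose endpoint `L-1` is joined by an edge to vertex
`L` of the clique on vertices `L, …, n-1`. -/
def pathClique (n L : ℕ) : SimpleGraph (Fin n) :=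
  SimpleGraph.fromRel fun i j =>
    (j.val = i.val + 1 ∧ j.val ≤ L) ∨ (L ≤ i.val ∧ L ≤ j.val)

/-- `G_n`: a path with `⌊log₂ n⌋` vertices attached to a clique on the remaining vertices. -/
def Ggraph (n : ℕ) : SimpleGraph (Fin n) := pathClique n (Nat.log 2 n)

/-- Two disjoint paths on `0, …, L-1` and `L, …, 2L-1`, whose endpoints `L-1` and `2L-1`
are each joined by an edge to vertex `2L` of the clique on vertices `2L, …, n-1`. -/
def twoPathClique (n L : ℕ) : SimpleGraph (Fin n) :=
  SimpleGraph.fromRel fun i j =>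
    (j.val = i.val + 1 ∧ j.val < L) ∨
    (L ≤ i.val ∧ j.val = i.val + 1 ∧ j.val < 2 * L) ∨
    (2 * L ≤ i.val ∧ 2 * L ≤ j.val) ∨
    (i.val + 1 = L ∧ j.val = 2 * L) ∨
    (i.val + 1 = 2 * L ∧ j.val = 2 * L)

/-- `L' = ⌊(1/2)·log₂ n + m⌋`. -/
noncomputable def Lp (n m : ℕ) : ℕ := ⌊Real.logb 2 n / 2 + m⌋₊

/-- `H_n` with parameter `m`: two paths with `L'` vertices each, attached to a clique on
the remaining `n - 2L'` vertices. -/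
noncomputable def Hgraph (n m : ℕ) : SimpleGraph (Fin n) := twoPathClique n (Lp n m)

lemma exists_walk_of_adj {V : Type*} {G : SimpleGraph V} (f : ℕ → V) :
    ∀ ℓ : ℕ, (∀ i < ℓ, G.Adj (f i) (f (i + 1))) → ∃ p : G.Walk (f 0) (f ℓ), p.length = ℓ := by
  intro ℓ
  induction ℓ with
  | zero => exact fun _ => ⟨.nil, rfl⟩
  | succ ℓ ih =>
    intro h
    obtain ⟨p, hp⟩ := ih fun i hi => h i (by omega)
    exact ⟨p.concat (h ℓ (by omega)), by simp [hp]⟩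

/-- From `C`, pebbling moves can place at least `k` pebbles on `v`. -/
def CanReach {V : Type*} [DecidableEq V] (G : SimpleGraph V) (C : V → ℕ) (v : V) (k : ℕ) : Prop :=
  ∃ C' : V → ℕ, Relation.ReflTransGen (PebblingMove G) C C' ∧ k ≤ C' v

section Moves

variable {V : Type*} [DecidableEq V] {G : SimpleGraph V}

lemma CanReach.of_le {C : V → ℕ} {v : V} {k : ℕ} (h : k ≤ C v) : CanReach G C v k :=
  ⟨C, .refl, h⟩

lemma CanReach.of_moves {C C' : V → ℕ} {v : V} {k : ℕ}
    (hC : Relation.ReflTransGen (PebblingMove G) C C') (h : CanReach G C' v k) :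
    CanReach G C v k := by
  obtain ⟨D, hD, hk⟩ := h
  exact ⟨D, hC.trans hD, hk⟩

/-- Moving `k` pebbles along an edge. -/
lemma exists_moves_of_adj {u v : V} (huv : G.Adj u v) (k : ℕ) :
    ∀ C : V → ℕ, 2 * k ≤ C u → ∃ C' : V → ℕ, Relation.ReflTransGen (PebblingMove G) C C' ∧
      C' v = C v + k ∧ ∀ w, w ≠ u → w ≠ v → C' w = C w := by
  have hne : v ≠ u := huv.ne'
  induction k with
  | zero => exact fun C _ => ⟨C, .refl, rfl, fun _ _ _ => rfl⟩
  | succ k ih =>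
    intro C hC
    obtain ⟨D, hD, hv, hw⟩ := ih
      (fun w => if w = u then C u - 2 else if w = v then C v + 1 else C w) (by simp; omega)
    refine ⟨D, .head ⟨u, v, huv, by omega, rfl⟩ hD, ?_, fun w h₁ h₂ => ?_⟩
    · simp [hne] at hv
      omega
    · simpa [h₁, h₂] using hw w h₁ h₂

lemma CanReach.of_adj {C : V → ℕ} {u v : V} {k : ℕ} (huv : G.Adj u v)
    (h : CanReach G C u (2 * k)) : CanReach G C v k := by
  obtain ⟨D, hD, hk⟩ := h
  obtain ⟨D', hD', hv, -⟩ := exists_moves_of_adj huv k D hk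
  exact ⟨D', hD.trans hD', by omega⟩

/-- Pebbles at the start of a walk of length `ℓ` lose at most a factor `2 ^ ℓ`. -/
lemma CanReach.of_walk {u v : V} (p : G.Walk u v) :
    ∀ {C : V → ℕ} {k : ℕ}, CanReach G C u (k * 2 ^ p.length) → CanReach G C v k := by
  induction p with
  | nil => intro C k h; simpa using h
  | cons h p ih =>
    intro C k hk
    refine ih (CanReach.of_adj h ?_)
    convert hk using 1
    rw [SimpleGraph.Walk.length_cons]
    ring

/-- The pebbles on a path of length `ℓ` together lose at most a factor `2 ^ ℓ` on their way to
its last vertex. -/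
lemma CanReach.of_path (ℓ : ℕ) : ∀ (f : ℕ → V) (C : V → ℕ) (k : ℕ),
    (∀ i < ℓ, G.Adj (f i) (f (i + 1))) → (∀ i ≤ ℓ, ∀ j ≤ ℓ, f i = f j → i = j) →
    k * 2 ^ ℓ ≤ ∑ i ∈ range (ℓ + 1), C (f i) → CanReach G C (f ℓ) k := by
  induction ℓ with
  | zero =>
    intro f C k _ _ h
    exact .of_le (by simpa using h)
  | succ ℓ ih =>
    intro f C k hadj hinj h
    obtain ⟨D, hD, h1, hw⟩ := exists_moves_of_adj (hadj 0 (by omega)) (C (f 0) / 2) C (by omega)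
    refine .of_moves hD (ih (fun i => f (i + 1)) D k (fun i hi => hadj (i + 1) (by omega))
      (fun i hi j hj hij => by have := hinj _ (by omega) _ (by omega) hij; omega) ?_)
    have hsum : ∑ i ∈ range ℓ, D (f (i + 1 + 1)) = ∑ i ∈ range ℓ, C (f (i + 1 + 1)) := by
      refine sum_congr rfl fun i hi => hw _ (fun h => ?_) (fun h => ?_)
      · have := hinj _ (by simp at hi; omega) _ (by omega) h; omega
      · have := hinj _ (by simp at hi; omega) _ (by omega) h; omega
    rw [sum_range_succ', hsum]
    rw [sum_range_succ', sum_range_succ'] at h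
    have : k * 2 ^ (ℓ + 1) = 2 * (k * 2 ^ ℓ) := by ring
    simp only [zero_add] at h h1 ⊢
    omega

/-- The pairs of pebbles on neighbours of `r` can be collected on `r`. -/
lemma exists_moves_to_common_neighbour (r : V) (A : Finset V) :
    (∀ u ∈ A, G.Adj u r) → ∀ C : V → ℕ, ∃ C' : V → ℕ,
      Relation.ReflTransGen (PebblingMove G) C C' ∧
      C' r = C r + ∑ u ∈ A, C u / 2 ∧ ∀ w ∉ A, w ≠ r → C' w = C w := by
  induction A using Finset.induction_on with
  | empty => exact fun _ C => ⟨C, .refl, by simp, fun _ _ _ => rfl⟩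
  | insert a A ha ih =>
    intro hA C
    obtain ⟨D, hD, hr, hw⟩ := ih (fun u hu => hA u (mem_insert_of_mem hu)) C
    have har : G.Adj a r := hA a (mem_insert_self _ _)
    have hDa : D a = C a := hw a ha har.ne
    obtain ⟨E, hE, hEr, hEw⟩ := exists_moves_of_adj har (D a / 2) D (by omega)
    refine ⟨E, hD.trans hE, ?_, fun w hwA hwr => ?_⟩
    · rw [hEr, hr, sum_insert ha, hDa]
      omega
    · rw [mem_insert, not_or] at hwA
      rw [hEw w hwA.1 hwr, hw w hwA.2 hwr]

/-- If all vertices are within distance `d` of `r` and the closed neighbourhood of `r` holds `2 ^ d`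
pairs of pebbles, then the configuration is solvable. -/
lemma solvable_of_pairs {r : V} {d : ℕ} (hr : ∀ v, ∃ p : G.Walk r v, p.length ≤ d)
    {A : Finset V} (hA : ∀ u ∈ A, u ≠ r → G.Adj u r) {C : V → ℕ}
    (hC : 2 ^ d ≤ ∑ u ∈ A, C u / 2) : Solvable G C := by
  intro v
  obtain ⟨p, hp⟩ := hr v
  obtain ⟨D, hD, hDr, -⟩ := exists_moves_to_common_neighbour r (A.erase r)
    (fun u hu => hA u (mem_of_mem_erase hu) (ne_of_mem_erase hu)) C
  refine CanReach.of_moves hD (CanReach.of_walk p (.of_le ?_))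
  have h1 : ∑ u ∈ A, C u / 2 ≤ C r / 2 + ∑ u ∈ A.erase r, C u / 2 := by
    by_cases h : r ∈ A
    · rw [add_sum_erase _ (fun u => C u / 2) h]
    · rw [erase_eq_of_notMem h]
      omega
  have h2 : 2 ^ p.length ≤ 2 ^ d := Nat.pow_le_pow_right (by norm_num) hp
  omega

/-- If all vertices are within distance `d` of `r` and some vertex has at least `2 ^ (2 * d)`
pebbles, then the configuration is solvable. -/
lemma solvable_of_large {r : V} {d : ℕ} (hr : ∀ v, ∃ p : G.Walk r v, p.length ≤ d)
    {C : V → ℕ} {u : V} (hC : 2 ^ (2 * d) ≤ C u) : Solvable G C := by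
  intro v
  obtain ⟨p, hp⟩ := hr u
  obtain ⟨q, hq⟩ := hr v
  refine CanReach.of_walk (p.reverse.append q) (.of_le ?_)
  have : 2 ^ (p.reverse.append q).length ≤ 2 ^ (2 * d) := by
    refine Nat.pow_le_pow_right (by norm_num) ?_
    simp
    omega
  omega

lemma solvable_of_sum_eq [Fintype V] {r : V} {d : ℕ}
    (hr : ∀ v, ∃ p : G.Walk r v, p.length ≤ d) {C : V → ℕ}
    (hC : ∑ v, C v = Fintype.card V * 2 ^ (2 * d)) : Solvable G C := by
  obtain ⟨u, -, hu⟩ := exists_le_of_sum_le (s := univ) (f := fun _ : V => 2 ^ (2 * d)) (g := C)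
    ⟨r, mem_univ r⟩ (by simp [hC])
  exact solvable_of_large hr hu

/-- A weight function which at most doubles along each edge does not increase under moves. -/
lemma sum_weight_le_of_moves [Fintype V] {w : V → ℕ} (hw : ∀ u v, G.Adj u v → w v ≤ 2 * w u)
    {C C' : V → ℕ} (h : Relation.ReflTransGen (PebblingMove G) C C') :
    ∑ v, C' v * w v ≤ ∑ v, C v * w v := by
  induction h with
  | refl => exact le_rfl
  | @tail D _ _ hm ih =>
    refine le_trans ?_ ih
    obtain ⟨u, v, huv, hu, rfl⟩ := hm
    have hvu : v ∈ univ.erase u := by simp [huv.ne']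
    rw [← add_sum_erase _ _ (mem_univ u), ← add_sum_erase _ _ (mem_univ u),
      ← add_sum_erase _ _ hvu, ← add_sum_erase _ (fun x => D x * w x) hvu]
    have hs : ∑ x ∈ (univ.erase u).erase v,
        (if x = u then D u - 2 else if x = v then D v + 1 else D x) * w x =
        ∑ x ∈ (univ.erase u).erase v, D x * w x := by
      refine sum_congr rfl fun x hx => ?_
      simp only [mem_erase] at hx
      simp [hx.1, hx.2.1]
    rw [hs]
    have h1 := hw u v huv
    obtain ⟨a, ha⟩ := Nat.exists_eq_add_of_le hu
    simp only [if_true, if_neg huv.ne', ha, Nat.add_sub_cancel_left]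
    nlinarith

lemma weight_le_of_solvable [Fintype V] {w : V → ℕ} (hw : ∀ u v, G.Adj u v → w v ≤ 2 * w u)
    {C : V → ℕ} (h : Solvable G C) (v : V) : w v ≤ ∑ u, C u * w u := by
  obtain ⟨D, hD, hv⟩ := h v
  calc w v ≤ D v * w v := Nat.le_mul_of_pos_left _ hv
    _ ≤ ∑ u, D u * w u := single_le_sum (f := fun u => D u * w u) (by simp) (mem_univ v)
    _ ≤ _ := sum_weight_le_of_moves hw hD

end Moves

section Counting

lemma mem_configs {n t : ℕ} {C : Fin n → ℕ} : C ∈ configs n t ↔ ∑ i, C i = t := by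
  simp only [configs, mem_filter, Fintype.mem_piFinset, mem_range, and_iff_right_iff_imp]
  rintro rfl i
  exact Nat.lt_succ_of_le (single_le_sum (by simp) (mem_univ i))

lemma card_configs (n t : ℕ) : #(configs n t) = (n + t - 1).choose t := by
  let _ : Fintype {C : Fin n → ℕ // ∑ i, C i = t} :=
    Fintype.subtype (configs n t) fun _ => mem_configs
  have h := Sym.card_sym_eq_choose (α := Fin n) t
  rw [Fintype.card_fin, Fintype.card_congr (Sym.equivNatSumOfFintype (Fin n) t)] at h
  rw [← h]
  exact (Fintype.card_of_subtype _ fun _ => mem_configs).symm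

lemma configs_card_pos {n : ℕ} (hn : 0 < n) (t : ℕ) : 0 < #(configs n t) := by
  rw [card_configs]
  exact Nat.choose_pos (by omega)

/-- The average number of pebbles on a vertex is `t / n`. -/
lemma mul_sum_configs_apply {n t : ℕ} (v : Fin n) :
    n * ∑ C ∈ configs n t, C v = t * #(configs n t) := by
  have h : ∀ u : Fin n, ∑ C ∈ configs n t, C u = ∑ C ∈ configs n t, C v := by
    intro u
    have hm : ∀ C ∈ configs n t, C ∘ Equiv.swap u v ∈ configs n t := by
      intro C hC
      rw [mem_configs] at hC ⊢
      rw [← hC]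
      exact Equiv.sum_comp (Equiv.swap u v) C
    refine sum_nbij' (fun C => C ∘ Equiv.swap u v) (fun C => C ∘ Equiv.swap u v) hm hm ?_ ?_ ?_
    · intro C _; ext x; simp
    · intro C _; ext x; simp
    · intro C _; simp
  calc n * ∑ C ∈ configs n t, C v = ∑ u : Fin n, ∑ C ∈ configs n t, C u := by simp [h]
    _ = ∑ C ∈ configs n t, ∑ u, C u := sum_comm
    _ = ∑ C ∈ configs n t, t := sum_congr rfl fun C hC => mem_configs.1 hC
    _ = _ := by simp [mul_comm]

lemma mul_sum_configs_weight {n t : ℕ} (w : Fin n → ℕ) :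
    n * ∑ C ∈ configs n t, ∑ v, C v * w v = t * #(configs n t) * ∑ v, w v := by
  rw [sum_comm, mul_sum, mul_sum]
  refine sum_congr rfl fun v _ => ?_
  rw [← sum_mul, ← mul_assoc, mul_sum_configs_apply]

/-- Few configurations have many pebbles on a given set of vertices. -/
lemma mul_card_configs_le_sum {n t : ℕ} (P : Finset (Fin n)) (p : ℕ) :
    n * (#{C ∈ configs n t | p ≤ ∑ v ∈ P, C v} * p) ≤ t * #(configs n t) * #P := by
  have h := mul_sum_configs_weight (t := t) fun v : Fin n => if v ∈ P then 1 else 0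
  simp only [mul_ite, mul_one, mul_zero, sum_ite_mem, univ_inter, sum_const, smul_eq_mul] at h
  rw [← h]
  refine Nat.mul_le_mul_left _ ?_
  calc _ ≤ ∑ C ∈ configs n t with p ≤ ∑ v ∈ P, C v, ∑ v ∈ P, C v :=
        card_nsmul_le_sum _ _ _ fun C hC => (mem_filter.1 hC).2
    _ ≤ _ := sum_le_sum_of_subset (filter_subset _ _)

lemma sum_le_two_mul_pairs_add_card {V : Type*} (A : Finset V) (C : V → ℕ) :
    ∑ u ∈ A, C u ≤ 2 * ∑ u ∈ A, C u / 2 + #{u ∈ A | 1 ≤ C u} := by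
  rw [card_filter, mul_sum, ← sum_add_distrib]
  refine sum_le_sum fun u _ => ?_
  split_ifs <;> omega

/-- Moving single pebbles within `A` shows that few configurations have few pairs of pebbles
on `A`. -/
lemma card_configs_few_pairs_mul_le {n t U s : ℕ} (A : Finset (Fin n)) :
    #{C ∈ configs n t | U ≤ #{u ∈ A | 1 ≤ C u} ∧ ∑ u ∈ A, C u / 2 ≤ s} * (U * (U - 1)) ≤
      #(configs n t) * (n * (s + 1)) := by
  set B := {C ∈ configs n t | U ≤ #{u ∈ A | 1 ≤ C u} ∧ ∑ u ∈ A, C u / 2 ≤ s} with hB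
  let X : Finset (Σ _ : Fin n → ℕ, Fin n × Fin n) :=
    B.sigma fun C => ({u ∈ A | 1 ≤ C u}).offDiag
  let Y : Finset (Σ _ : Fin n → ℕ, Fin n × Fin n) :=
    (configs n t).sigma fun C =>
      if ∑ u ∈ A, C u / 2 ≤ s + 1 then univ ×ˢ {u ∈ A | 2 ≤ C u} else ∅
  let φ : (Σ _ : Fin n → ℕ, Fin n × Fin n) → (Σ _ : Fin n → ℕ, Fin n × Fin n) := fun x =>
    ⟨fun w => if w = x.2.1 then x.1 w - 1 else if w = x.2.2 then x.1 w + 1 else x.1 w, x.2⟩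
  have hX : #B * (U * (U - 1)) ≤ #X := by
    rw [card_sigma]
    refine card_nsmul_le_sum _ _ _ fun C hC => ?_
    have hU := (mem_filter.1 hC).2.1
    rw [offDiag_card, ← Nat.mul_sub_one]
    exact Nat.mul_le_mul hU (by omega)
  have hY : #Y ≤ #(configs n t) * (n * (s + 1)) := by
    rw [card_sigma]
    refine sum_le_card_nsmul _ _ _ fun C hC => ?_
    split_ifs with h
    · rw [card_product, card_univ, Fintype.card_fin]
      refine Nat.mul_le_mul_left _ (le_trans ?_ h)
      rw [card_filter]
      refine sum_le_sum fun u _ => ?_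
      split_ifs <;> omega
    · simp
  refine hX.trans (le_trans ?_ hY)
  refine card_le_card_of_injOn φ ?_ ?_
  · rintro ⟨C, i, j⟩ hx
    simp only [X, coe_sigma, Set.mem_sigma_iff, mem_coe, mem_offDiag, mem_filter, hB] at hx
    obtain ⟨⟨hC, -, hs⟩, ⟨hi, hi1⟩, ⟨hj, hj1⟩, hij⟩ := hx
    have hsum : ∀ (S : Finset (Fin n)) (g : ℕ → ℕ), i ∈ S → j ∈ S →
        ∑ w ∈ S, g (if w = i then C w - 1 else if w = j then C w + 1 else C w) +
          (g (C i) + g (C j)) = ∑ w ∈ S, g (C w) + (g (C i - 1) + g (C j + 1)) := by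
      intro S g hiS hjS
      have hjS' : j ∈ S.erase i := by simp [hjS, Ne.symm hij]
      rw [← add_sum_erase _ _ hiS, ← add_sum_erase _ _ hjS',
        ← add_sum_erase _ (fun w => g (C w)) hiS,
        ← add_sum_erase _ (fun w => g (C w)) hjS']
      have : ∑ w ∈ (S.erase i).erase j,
          g (if w = i then C w - 1 else if w = j then C w + 1 else C w) =
          ∑ w ∈ (S.erase i).erase j, g (C w) := by
        refine sum_congr rfl fun w hw => ?_
        simp only [mem_erase] at hw
        simp [hw.1, hw.2.1]
      rw [this]
      simp only [if_true, if_neg (Ne.symm hij)]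
      omega
    have h1 := hsum univ id (mem_univ _) (mem_univ _)
    have h2 := hsum A (· / 2) hi hj
    simp only [id] at h1
    rw [mem_configs] at hC
    have h3 : ∑ u ∈ A, (if u = i then C u - 1 else if u = j then C u + 1 else C u) / 2 ≤ s + 1 := by
      omega
    simp only [Y, φ, coe_sigma, Set.mem_sigma_iff, mem_coe, mem_configs, h3, if_true, mem_product,
      mem_univ, true_and, mem_filter, hj, Ne.symm hij, if_false]
    omega
  · rintro ⟨C, i, j⟩ hx ⟨C', i', j'⟩ hx' h
    simp only [X, coe_sigma, Set.mem_sigma_iff, mem_coe, mem_offDiag, mem_filter] at hx hx'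
    simp only [φ, Sigma.mk.injEq, heq_eq_eq, Prod.mk.injEq] at h
    obtain ⟨h, rfl, rfl⟩ := h
    have : C = C' := by
      ext w
      have hw := congrFun h w
      by_cases h1 : w = i
      · subst h1
        simp at hw
        omega
      · by_cases h2 : w = j
        · subst h2
          simp [h1] at hw
          omega
        · simpa [h1, h2] using hw
    rw [this]

end Counting

section Thresholds

variable {n : ℕ} {G : SimpleGraph (Fin n)}

open scoped Classical in
lemma solvableProportion_eq (t : ℕ) :
    solvableProportion n G t = (#{C ∈ configs n t | Solvable G C} : ℝ) / #(configs n t) := by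
  rw [solvableProportion, card_configs]

lemma exists_half_le_solvableProportion (hn : 0 < n) {t : ℕ}
    (h : ∀ C : Fin n → ℕ, ∑ v, C v = t → Solvable G C) : 1 / 2 ≤ solvableProportion n G t := by
  classical
  have h0 := configs_card_pos hn t
  rw [solvableProportion_eq, filter_true_of_mem fun C hC => h C (mem_configs.1 hC), div_self]
  · norm_num
  · positivity

end Thresholds

section PathClique

variable {n L : ℕ}

lemma pathClique_adj {i j : Fin n} :
    (pathClique n L).Adj i j ↔ i ≠ j ∧
      ((j.val = i.val + 1 ∧ j.val ≤ L ∨ L ≤ i.val ∧ L ≤ j.val) ∨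
        (i.val = j.val + 1 ∧ i.val ≤ L ∨ L ≤ j.val ∧ L ≤ i.val)) :=
  SimpleGraph.fromRel_adj _ _ _

lemma val_ofNat_of_lt [NeZero n] {i : ℕ} (h : i < n) : (Fin.ofNat n i).val = i :=
  Nat.mod_eq_of_lt h

lemma pathClique_exists_walk [NeZero n] (hL : 0 < L) (hn : L < n) (v : Fin n) :
    ∃ p : (pathClique n L).Walk (Fin.ofNat n L) v, p.length ≤ L := by
  have hr := val_ofNat_of_lt hn
  rcases lt_trichotomy v.val L with h | h | h
  · obtain ⟨p, hp⟩ := exists_walk_of_adj (G := pathClique n L) (fun i => Fin.ofNat n (L - i))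
      (L - v.val) (fun i hi => by
        have h1 := val_ofNat_of_lt (n := n) (i := L - i) (by omega)
        have h2 := val_ofNat_of_lt (n := n) (i := L - (i + 1)) (by omega)
        rw [pathClique_adj, Ne, Fin.ext_iff, h1, h2]
        omega)
    have hv : Fin.ofNat n (L - (L - v.val)) = v := by
      rw [Fin.ext_iff, val_ofNat_of_lt (by omega)]
      omega
    exact ⟨p.copy (by simp) hv, by simp; omega⟩
  · obtain rfl : Fin.ofNat n L = v := Fin.ext (by omega)
    exact ⟨.nil, by simp⟩
  · exact ⟨.cons (by rw [pathClique_adj, Ne, Fin.ext_iff]; omega) .nil, by simpa using Nat.succ_le_of_lt hL⟩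

lemma sum_filter_val_lt_eq_sum_range {n L : ℕ} [NeZero n] (hn : L ≤ n) (C : Fin n → ℕ) :
    ∑ v with v.val < L, C v = ∑ i ∈ range L, C (Fin.ofNat n i) := by
  refine sum_nbij' (fun v => v.val) (fun i => Fin.ofNat n i) ?_ ?_ ?_ ?_ ?_
  · intro v hv
    simpa using hv
  · intro i hi
    rw [mem_range] at hi
    simpa [Nat.mod_eq_of_lt (hi.trans_le hn)] using hi
  · intro v _
    exact Fin.ext (val_ofNat_of_lt v.isLt)
  · intro i hi
    exact val_ofNat_of_lt ((mem_range.1 hi).trans_le hn)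
  · intro v _
    rw [show Fin.ofNat n v.val = v from Fin.ext (val_ofNat_of_lt v.isLt)]

/-- A linear upper bound for the pebbling number of `pathClique`. -/
lemma pathClique_solvable (hL : 0 < L) (hn : L < n) {C : Fin n → ℕ}
    (hC : 6 * 2 ^ L + n ≤ ∑ v, C v) : Solvable (pathClique n L) C := by
  have : NeZero n := ⟨by omega⟩
  by_cases hS : 2 ^ L ≤ ∑ u with L ≤ u.val, C u / 2
  · refine solvable_of_pairs (pathClique_exists_walk hL hn) (fun u hu hur => ?_) hS
    have hr := val_ofNat_of_lt hn
    have hu' := (mem_filter.1 hu).2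
    rw [Ne, Fin.ext_iff] at hur
    rw [pathClique_adj, Ne, Fin.ext_iff]
    omega
  have hA := sum_le_two_mul_pairs_add_card ({u : Fin n | L ≤ u.val} : Finset (Fin n)) C
  have hcard : #{u ∈ ({u : Fin n | L ≤ u.val} : Finset (Fin n)) | 1 ≤ C u} ≤ n :=
    (card_le_univ _).trans_eq (Fintype.card_fin n)
  have hsplit := sum_filter_add_sum_filter_not univ (fun v : Fin n => v.val < L) C
  simp only [not_lt] at hsplit
  rw [sum_filter_val_lt_eq_sum_range hn.le] at hsplit
  have hP : 4 * 2 ^ L ≤ ∑ i ∈ range L, C (Fin.ofNat n i) := by omega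
  intro v
  rcases lt_or_ge v.val L with hv | hv
  · rcases le_or_gt (2 ^ L) (∑ i ∈ range (v.val + 1), C (Fin.ofNat n i)) with h | h
    · have h2 : 2 ^ v.val ≤ 2 ^ L := Nat.pow_le_pow_right (by norm_num) hv.le
      have := CanReach.of_path (G := pathClique n L) v.val (fun i => Fin.ofNat n i) C 1
        (fun i hi => by
          have h1 := val_ofNat_of_lt (n := n) (i := i) (by omega)
          have h2 := val_ofNat_of_lt (n := n) (i := i + 1) (by omega)
          rw [pathClique_adj, Ne, Fin.ext_iff, h1, h2]
          omega)
        (fun i hi j hj hij => by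
          rwa [Fin.ext_iff, val_ofNat_of_lt (by omega), val_ofNat_of_lt (by omega)] at hij)
        (by omega)
      rwa [show Fin.ofNat n v.val = v from Fin.ext (val_ofNat_of_lt v.isLt)] at this
    · have h2 : 2 ^ (L - 1 - v.val) ≤ 2 ^ L := Nat.pow_le_pow_right (by norm_num) (by omega)
      have hsum : ∑ i ∈ range (L - v.val), C (Fin.ofNat n (L - 1 - i)) =
          ∑ i ∈ Ico v.val L, C (Fin.ofNat n i) := by
        rw [← Nat.Ico_zero_eq_range, sum_Ico_reflect (fun i => C (Fin.ofNat n i)) 0 (by omega)]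
        congr 2 <;> omega
      have h3 := sum_range_add_sum_Ico (fun i => C (Fin.ofNat n i)) hv.le
      rw [sum_range_succ] at h
      have := CanReach.of_path (G := pathClique n L) (L - 1 - v.val)
        (fun i => Fin.ofNat n (L - 1 - i)) C 1
        (fun i hi => by
          have h1 := val_ofNat_of_lt (n := n) (i := L - 1 - i) (by omega)
          have h2 := val_ofNat_of_lt (n := n) (i := L - 1 - (i + 1)) (by omega)
          rw [pathClique_adj, Ne, Fin.ext_iff, h1, h2]
          omega)
        (fun i hi j hj hij => by
          rw [Fin.ext_iff, val_ofNat_of_lt (by omega), val_ofNat_of_lt (by omega)] at hij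
          omega)
        (by
          rw [show L - 1 - v.val + 1 = L - v.val by omega, hsum]
          omega)
      rwa [show Fin.ofNat n (L - 1 - (L - 1 - v.val)) = v from
        Fin.ext (by rw [val_ofNat_of_lt (by omega)]; omega)] at this
  · have hr := val_ofNat_of_lt hn
    have h2 : CanReach (pathClique n L) C (Fin.ofNat n L) 2 :=
      CanReach.of_path (G := pathClique n L) L (fun i => Fin.ofNat n i) C 2
        (fun i hi => by
          have h1 := val_ofNat_of_lt (n := n) (i := i) (by omega)
          have h2 := val_ofNat_of_lt (n := n) (i := i + 1) (by omega)
          rw [pathClique_adj, Ne, Fin.ext_iff, h1, h2]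
          omega)
        (fun i hi j hj hij => by
          rwa [Fin.ext_iff, val_ofNat_of_lt (by omega), val_ofNat_of_lt (by omega)] at hij)
        (by
          rw [sum_range_succ]
          omega)
    by_cases hvr : v = Fin.ofNat n L
    · subst hvr
      obtain ⟨D, hD, hk⟩ := h2
      exact ⟨D, hD, by omega⟩
    · refine CanReach.of_adj (u := Fin.ofNat n L) ?_ h2
      rw [Fin.ext_iff] at hvr
      rw [pathClique_adj, Ne, Fin.ext_iff]
      omega

lemma pebblingNumber_pathClique_le (hL : 0 < L) (hn : L < n) :
    pebblingNumber (pathClique n L) ≤ 6 * 2 ^ L + n :=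
  Nat.sInf_le fun _ hC => pathClique_solvable hL hn hC.ge

lemma sum_range_two_pow_sub_le (k n : ℕ) : ∑ i ∈ range n, 2 ^ (k - i) ≤ 2 ^ (k + 1) + n := by
  induction k generalizing n with
  | zero => simp
  | succ k ih =>
    cases n with
    | zero => simp
    | succ n =>
      have := ih n
      simp only [sum_range_succ', Nat.add_sub_add_right, Nat.sub_zero]
      rw [pow_succ 2 (k + 1)]
      omega

/-- Unless there are linearly many pebbles, less than half of the configurations on `pathClique`
are solvable. -/
lemma le_of_half_le_solvableProportion_pathClique {t : ℕ} (hn : 0 < n) (hnL : n ≤ 2 ^ (L + 1))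
    (h : 1 / 2 ≤ solvableProportion n (pathClique n L) t) : n ≤ 6 * t := by
  classical
  have h0 := configs_card_pos hn t
  rw [solvableProportion_eq, div_le_div_iff₀ (by norm_num) (by positivity)] at h
  have h1 : #(configs n t) ≤ 2 * #{C ∈ configs n t | Solvable (pathClique n L) C} := by
    have : (#(configs n t) : ℝ) ≤ 2 * #{C ∈ configs n t | Solvable (pathClique n L) C} := by
      linarith
    exact_mod_cast this
  let w : Fin n → ℕ := fun v => 2 ^ (L + 1 - v.val)
  have hw : ∀ u v, (pathClique n L).Adj u v → w v ≤ 2 * w u := by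
    intro u v huv
    rw [pathClique_adj, Ne, Fin.ext_iff] at huv
    rw [← pow_succ']
    exact Nat.pow_le_pow_right (by norm_num) (by omega)
  have h2 : #{C ∈ configs n t | Solvable (pathClique n L) C} * 2 ^ (L + 1) ≤
      ∑ C ∈ configs n t, ∑ v, C v * w v := by
    calc _ ≤ ∑ C ∈ configs n t with Solvable (pathClique n L) C, ∑ v, C v * w v :=
          card_nsmul_le_sum _ _ _ fun C hC =>
            weight_le_of_solvable hw (mem_filter.1 hC).2 ⟨0, hn⟩
      _ ≤ _ := sum_le_sum_of_subset (filter_subset _ _)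
  have h3 := mul_sum_configs_weight (t := t) w
  have h4 : ∑ v, w v ≤ 3 * 2 ^ (L + 1) := by
    have := sum_range_two_pow_sub_le (L + 1) n
    rw [← Fin.sum_univ_eq_sum_range (fun i => 2 ^ (L + 1 - i)), pow_succ 2 (L + 1)] at this
    change ∑ v : Fin n, 2 ^ (L + 1 - v.val) ≤ _
    omega
  have h5 : n * (#(configs n t) * 2 ^ (L + 1)) ≤ 6 * t * (#(configs n t) * 2 ^ (L + 1)) := by
    calc n * (#(configs n t) * 2 ^ (L + 1))
        ≤ n * (2 * #{C ∈ configs n t | Solvable (pathClique n L) C} * 2 ^ (L + 1)) := by gcongr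
      _ = 2 * (n * (#{C ∈ configs n t | Solvable (pathClique n L) C} * 2 ^ (L + 1))) := by ring
      _ ≤ 2 * (n * ∑ C ∈ configs n t, ∑ v, C v * w v) := by gcongr
      _ = 2 * (t * #(configs n t) * ∑ v, w v) := by rw [h3]
      _ ≤ 2 * (t * #(configs n t) * (3 * 2 ^ (L + 1))) := by gcongr
      _ = _ := by ring
  exact Nat.le_of_mul_le_mul_right h5 (by positivity)

lemma le_six_mul_tauAlpha_pathClique (hL : 0 < L) (hn : L < n) (hnL : n ≤ 2 ^ (L + 1)) :
    n ≤ 6 * tauAlpha n (pathClique n L) (1 / 2) :=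
  le_of_half_le_solvableProportion_pathClique (by omega) hnL
    (Nat.sInf_mem (s := {t | 1 / 2 ≤ solvableProportion n (pathClique n L) t})
      ⟨_, exists_half_le_solvableProportion (by omega) fun _ hC =>
        pathClique_solvable hL hn hC.ge⟩)

end PathClique

section TwoPathClique

variable {n L : ℕ}

lemma twoPathClique_adj {i j : Fin n} :
    (twoPathClique n L).Adj i j ↔ i ≠ j ∧
      ((j.val = i.val + 1 ∧ j.val < L ∨
        L ≤ i.val ∧ j.val = i.val + 1 ∧ j.val < 2 * L ∨
        2 * L ≤ i.val ∧ 2 * L ≤ j.val ∨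
        i.val + 1 = L ∧ j.val = 2 * L ∨
        i.val + 1 = 2 * L ∧ j.val = 2 * L) ∨
      (i.val = j.val + 1 ∧ i.val < L ∨
        L ≤ j.val ∧ i.val = j.val + 1 ∧ i.val < 2 * L ∨
        2 * L ≤ j.val ∧ 2 * L ≤ i.val ∨
        j.val + 1 = L ∧ i.val = 2 * L ∨
        j.val + 1 = 2 * L ∧ i.val = 2 * L)) :=
  SimpleGraph.fromRel_adj _ _ _

lemma twoPathClique_adj_of_eq_succ {i j : Fin n} (hij : i.val = j.val + 1) (hj : L ≤ j.val)
    (hi : i.val ≤ 2 * L) : (twoPathClique n L).Adj i j := by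
  refine twoPathClique_adj.2 ⟨fun h => by simp [h] at hij, Or.inr ?_⟩
  rcases hi.lt_or_eq with hi | hi
  · exact Or.inr (Or.inl ⟨hj, hij, hi⟩)
  · exact Or.inr (Or.inr (Or.inr (Or.inr ⟨by omega, hi⟩)))

lemma twoPathClique_exists_walk [NeZero n] (hL : 0 < L) (hn : 2 * L < n) (v : Fin n) :
    ∃ p : (twoPathClique n L).Walk (Fin.ofNat n (2 * L)) v, p.length ≤ L := by
  have hr := val_ofNat_of_lt hn
  rcases lt_or_ge v.val L with h | h
  · obtain ⟨p, hp⟩ := exists_walk_of_adj (G := twoPathClique n L)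
      (fun i => Fin.ofNat n (if i = 0 then 2 * L else L - i)) (L - v.val) (fun i hi => by
        have h1 := val_ofNat_of_lt (n := n) (i := if i = 0 then 2 * L else L - i)
          (by split_ifs <;> omega)
        have h2 := val_ofNat_of_lt (n := n) (i := if i + 1 = 0 then 2 * L else L - (i + 1))
          (by split_ifs <;> omega)
        rw [twoPathClique_adj, Ne, Fin.ext_iff, h1, h2, if_neg (Nat.succ_ne_zero i)]
        split_ifs <;> omega)
    have hv : Fin.ofNat n (if L - v.val = 0 then 2 * L else L - (L - v.val)) = v := by
      rw [if_neg (by omega), Fin.ext_iff, val_ofNat_of_lt (by omega)]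
      omega
    exact ⟨p.copy (by simp) hv, by simp; omega⟩
  rcases lt_trichotomy v.val (2 * L) with h' | h' | h'
  · obtain ⟨p, hp⟩ := exists_walk_of_adj (G := twoPathClique n L)
      (fun i => Fin.ofNat n (2 * L - i)) (2 * L - v.val) (fun i hi => by
        have h1 := val_ofNat_of_lt (n := n) (i := 2 * L - i) (by omega)
        have h2 := val_ofNat_of_lt (n := n) (i := 2 * L - (i + 1)) (by omega)
        exact twoPathClique_adj_of_eq_succ (by omega) (by omega) (by omega))
    have hv : Fin.ofNat n (2 * L - (2 * L - v.val)) = v := by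
      rw [Fin.ext_iff, val_ofNat_of_lt (by omega)]
      omega
    exact ⟨p.copy (by simp) hv, by simp; omega⟩
  · obtain rfl : Fin.ofNat n (2 * L) = v := Fin.ext (by omega)
    exact ⟨.nil, by simp⟩
  · exact ⟨.cons (by rw [twoPathClique_adj, Ne, Fin.ext_iff]; omega) .nil, by simpa using Nat.succ_le_of_lt hL⟩

/-- The two path ends are at distance `2 * L`, which bounds the pebbling number from below. -/
lemma le_pebblingNumber_twoPathClique (hL : 0 < L) (hn : 2 * L < n) :
    2 ^ (2 * L) ≤ pebblingNumber (twoPathClique n L) := by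
  have : NeZero n := ⟨by omega⟩
  refine le_csInf ⟨_, fun C hC => solvable_of_sum_eq (twoPathClique_exists_walk hL hn) hC⟩ ?_
  intro t ht
  let w : Fin n → ℕ := fun v =>
    2 ^ (if v.val < L then v.val else if v.val < 2 * L then 3 * L - v.val else L)
  have hw : ∀ u v, (twoPathClique n L).Adj u v → w v ≤ 2 * w u := by
    intro u v huv
    rw [twoPathClique_adj, Ne, Fin.ext_iff] at huv
    rw [← pow_succ']
    refine Nat.pow_le_pow_right (by norm_num) ?_
    split_ifs <;> omega
  obtain ⟨z, hz⟩ : ∃ z : Fin n, z.val = 0 := ⟨⟨0, by omega⟩, rfl⟩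
  have h := weight_le_of_solvable hw (ht (fun v => if v = z then t else 0) (by simp)) ⟨L, by omega⟩
  have h0 : w z = 1 := by simp [w, hz, hL]
  have h1 : w ⟨L, by omega⟩ = 2 ^ (2 * L) := by
    simp only [w, lt_irrefl, if_false, if_pos (show L < 2 * L by omega)]
    congr 1
    omega
  simpa [h0, h1] using h

/-- With enough pebbles to expect many pairs, most configurations on `twoPathClique` are
solvable. -/
lemma half_le_solvableProportion_twoPathClique {t U : ℕ} (hL : 0 < L) (hn : 2 * L < n)
    (htn : t ≤ n) (hU : U + 8 * L + 2 * 2 ^ L ≤ t) (hU' : 4 * (n * (2 ^ L + 1)) ≤ U * (U - 1)) :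
    1 / 2 ≤ solvableProportion n (twoPathClique n L) t := by
  classical
  have : NeZero n := ⟨by omega⟩
  have h0 := configs_card_pos (show 0 < n by omega) t
  let P : Finset (Fin n) := {v | v.val < 2 * L}
  let A : Finset (Fin n) := {v | ¬ v.val < 2 * L}
  set X := #{C ∈ configs n t | 8 * L ≤ ∑ v ∈ P, C v}
  set Y := #{C ∈ configs n t | U ≤ #{u ∈ A | 1 ≤ C u} ∧ ∑ u ∈ A, C u / 2 ≤ 2 ^ L}
  have hX : 4 * X ≤ #(configs n t) := by
    have hP : #P ≤ 2 * L := by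
      have := sum_filter_val_lt_eq_sum_range hn.le (fun _ => 1)
      simpa [P] using this.le
    have h1 : n * (X * (8 * L)) ≤ t * #(configs n t) * #P := mul_card_configs_le_sum P (8 * L)
    have h2 : t * #(configs n t) * #P ≤ n * #(configs n t) * (2 * L) := by gcongr
    have h3 : (2 * n * L) * (4 * X) ≤ (2 * n * L) * #(configs n t) := by nlinarith
    refine Nat.le_of_mul_le_mul_left h3 ?_
    have : 0 < n := by omega
    positivity
  have hY : 4 * Y ≤ #(configs n t) := by
    have h1 : Y * (U * (U - 1)) ≤ #(configs n t) * (n * (2 ^ L + 1)) :=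
      card_configs_few_pairs_mul_le A
    have h2 : Y * (4 * (n * (2 ^ L + 1))) ≤ Y * (U * (U - 1)) := by gcongr
    have h3 : (n * (2 ^ L + 1)) * (4 * Y) ≤ (n * (2 ^ L + 1)) * #(configs n t) := by nlinarith
    refine Nat.le_of_mul_le_mul_left h3 ?_
    have : 0 < n := by omega
    positivity
  have hbad : #{C ∈ configs n t | ¬ Solvable (twoPathClique n L) C} ≤ X + Y := by
    refine le_trans (card_le_card ?_) (card_union_le _ _)
    intro C hC
    rw [mem_filter] at hC
    rw [mem_union, mem_filter, mem_filter]
    by_cases hP : 8 * L ≤ ∑ v ∈ P, C v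
    · exact Or.inl ⟨hC.1, hP⟩
    refine Or.inr ⟨hC.1, ?_⟩
    have hS : ∑ u ∈ A, C u / 2 < 2 ^ L := by
      by_contra! hS
      refine hC.2 (solvable_of_pairs (twoPathClique_exists_walk hL hn) (fun u hu hur => ?_) hS)
      have hr := val_ofNat_of_lt hn
      have hu' := (mem_filter.1 hu).2
      rw [Ne, Fin.ext_iff] at hur
      rw [twoPathClique_adj, Ne, Fin.ext_iff]
      omega
    have h1 := sum_le_two_mul_pairs_add_card A C
    have h2 : ∑ v ∈ P, C v + ∑ v ∈ A, C v = ∑ v, C v :=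
      sum_filter_add_sum_filter_not univ (fun v : Fin n => v.val < 2 * L) C
    have h3 := mem_configs.1 hC.1
    constructor <;> omega
  have hadd := card_filter_add_card_filter_not (s := configs n t)
    (fun C => Solvable (twoPathClique n L) C)
  have hle : #(configs n t) ≤ 2 * #{C ∈ configs n t | Solvable (twoPathClique n L) C} := by omega
  rw [solvableProportion_eq, div_le_div_iff₀ (by norm_num) (by positivity)]
  have : (#(configs n t) : ℝ) ≤ 2 * #{C ∈ configs n t | Solvable (twoPathClique n L) C} := by
    exact_mod_cast hle
  linarith

end TwoPathClique

section Asymptotics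

open Filter

lemma two_pow_Lp_le {n : ℕ} (hn : 0 < n) (m : ℕ) : (2 : ℝ) ^ Lp n m ≤ 2 ^ m * √n := by
  have hn' : (1 : ℝ) ≤ n := by exact_mod_cast hn
  have h0 : 0 ≤ Real.logb 2 n := Real.logb_nonneg (by norm_num) hn'
  have h1 : (Lp n m : ℝ) ≤ Real.logb 2 n / 2 + m := Nat.floor_le (by positivity)
  calc (2 : ℝ) ^ Lp n m = (2 : ℝ) ^ (Lp n m : ℝ) := (Real.rpow_natCast _ _).symm
    _ ≤ (2 : ℝ) ^ (Real.logb 2 n * (1 / 2) + m) :=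
      Real.rpow_le_rpow_of_exponent_le (by norm_num) (by linarith)
    _ = 2 ^ m * √n := by
      rw [Real.rpow_add (by norm_num), Real.rpow_mul (by norm_num),
        Real.rpow_logb (by norm_num) (by norm_num) (by positivity), Real.rpow_natCast,
        Real.sqrt_eq_rpow, mul_comm]

lemma mul_le_two_pow_two_mul_Lp {n m : ℕ} (hn : 0 < n) (hm : 3 ≤ m) :
    16 * n ≤ 2 ^ (2 * Lp n m) := by
  have hn' : (0 : ℝ) < n := by exact_mod_cast hn
  have hm' : (3 : ℝ) ≤ m := by exact_mod_cast hm
  have h1 : Real.logb 2 n / 2 + m < Lp n m + 1 := Nat.lt_floor_add_one _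
  have h2 : (16 * n : ℝ) ≤ 2 ^ (2 * Lp n m) := by
    calc (16 * n : ℝ) = (2 : ℝ) ^ (Real.logb 2 n + (4 : ℕ)) := by
          rw [Real.rpow_add (by norm_num), Real.rpow_logb (by norm_num) (by norm_num) hn',
            Real.rpow_natCast]
          norm_num
          ring
      _ ≤ (2 : ℝ) ^ ((2 * Lp n m : ℕ) : ℝ) :=
          Real.rpow_le_rpow_of_exponent_le (by norm_num) (by push_cast; linarith)
      _ = _ := Real.rpow_natCast _ _
  exact_mod_cast h2

lemma Lp_pos {n m : ℕ} (hn : 0 < n) (hm : 0 < m) : 0 < Lp n m := by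
  have h0 : 0 ≤ Real.logb 2 n := Real.logb_nonneg (by norm_num) (by exact_mod_cast hn)
  have hm' : (1 : ℝ) ≤ m := by exact_mod_cast hm
  exact Nat.floor_pos.2 (by linarith)

lemma eventually_mul_sqrt_add_le (A B : ℝ) {b : ℝ} (hb : 0 < b) :
    ∀ᶠ n : ℕ in atTop, A * √n + B ≤ b * n := by
  have h := Real.tendsto_sqrt_atTop.comp (tendsto_natCast_atTop_atTop (R := ℝ))
  filter_upwards [h.eventually_ge_atTop 1, h.eventually_ge_atTop ((|A| + |B|) / b)] with n h1 h2
  simp only [Function.comp_apply] at h1 h2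
  rw [div_le_iff₀ hb] at h2
  have hs : √(n : ℝ) * √n = n := Real.mul_self_sqrt (Nat.cast_nonneg n)
  calc A * √n + B ≤ |A| * √n + |B| * √n := by
        have := mul_le_mul_of_nonneg_right (le_abs_self A) (Real.sqrt_nonneg n)
        have := le_mul_of_one_le_right (abs_nonneg B) h1
        have := le_abs_self B
        linarith
    _ = (|A| + |B|) * √n := by ring
    _ ≤ √n * b * √n := by gcongr
    _ = b * (√n * √n) := by ring
    _ = b * n := by rw [hs]

/-- Linearly many pebbles, with an arbitrarily small constant, suffice for `H_n`. -/
lemma eventually_half_le_solvableProportion_Hgraph {m : ℕ} (hm : 0 < m) {a : ℝ} (ha : 0 < a)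
    (ha1 : a ≤ 1) :
    ∀ᶠ n : ℕ in atTop, 2 * Lp n m < n ∧ 1 / 2 ≤ solvableProportion n (Hgraph n m) ⌊a * n⌋₊ := by
  filter_upwards [eventually_gt_atTop 0,
    eventually_mul_sqrt_add_le (10 * 2 ^ m) 2 (half_pos ha),
    eventually_mul_sqrt_add_le (4 * 2 ^ m) 4 (pow_pos (half_pos ha) 2)] with n hn h1 h2
  have hs := two_pow_Lp_le hn m
  have hL := Lp_pos hn hm
  have hLs : Lp n m < 2 ^ Lp n m := Nat.lt_two_pow_self
  set t := ⌊a * n⌋₊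
  have ht : a * n < t + 1 := Nat.lt_floor_add_one _
  have htn : t ≤ n := by
    refine Nat.floor_le_of_le ?_
    exact mul_le_of_le_one_left (Nat.cast_nonneg n) ha1
  have hn0 : (0 : ℝ) < n := by exact_mod_cast hn
  have han : 0 < a / 2 * n := by positivity
  have hst : 10 * 2 ^ Lp n m ≤ t := by
    have : (10 * 2 ^ Lp n m : ℝ) ≤ t := by linarith
    exact_mod_cast this
  obtain ⟨U, hU⟩ := Nat.exists_eq_add_of_le hst
  have hU' : a / 2 * n + 1 ≤ U := by
    have : (t : ℝ) = 10 * 2 ^ Lp n m + U := by exact_mod_cast hU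
    linarith
  have hU1 : 1 ≤ U := by
    have : (1 : ℝ) ≤ U := by linarith
    exact_mod_cast this
  refine ⟨by omega, half_le_solvableProportion_twoPathClique (U := U) hL (by omega) htn
    (by omega) ?_⟩
  have : (4 * (n * (2 ^ Lp n m + 1)) : ℝ) ≤ U * (U - 1) := by
    calc (4 * (n * (2 ^ Lp n m + 1)) : ℝ) = n * (4 * 2 ^ Lp n m + 4) := by ring
      _ ≤ n * ((a / 2) ^ 2 * n) := by gcongr; linarith
      _ = (a / 2 * n) * (a / 2 * n) := by ring
      _ ≤ U * (U - 1) := by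
        refine mul_le_mul (by linarith) (by linarith) han.le (by positivity)
  have hcast : ((U - 1 : ℕ) : ℝ) = U - 1 := by simp [Nat.cast_sub hU1]
  rw [← hcast] at this
  exact_mod_cast this

end Asymptotics

/-- With `m = 1000`: (i) eventually `π(G_n) < π(H_n)`; (ii)
`τ_{1/2}(G_n)/τ_{1/2}(H_n) → ∞`, i.e. for every `c > 0`, eventually
`τ_{1/2}(G_n) > c·τ_{1/2}(H_n)`. In particular `τ_{1/2}(G_n) ∉ O(τ_{1/2}(H_n))`,
disproving the conjecture of Hurlbert et al. -/
theorem counterexample_to_conjecture :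
    (∃ N : ℕ, ∀ n : ℕ, N ≤ n →
        pebblingNumber (Ggraph n) < pebblingNumber (Hgraph n 1000)) ∧
      ∀ c : ℝ, 0 < c →
        ∀ᶠ n : ℕ in Filter.atTop,
          c * (tauAlpha n (Hgraph n 1000) (1 / 2) : ℝ) <
            (tauAlpha n (Ggraph n) (1 / 2) : ℝ) := by
  have hpos : ∀ n, 2 ≤ n → 0 < Nat.log 2 n := fun n hn => Nat.log_pos (by norm_num) hn
  have hlog : ∀ n, 2 ≤ n → Nat.log 2 n < n := fun n hn => Nat.log_lt_self 2 (by omega)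
  constructor
  · rw [← Filter.eventually_atTop]
    filter_upwards [Filter.eventually_ge_atTop 2,
      eventually_half_le_solvableProportion_Hgraph (m := 1000) (by norm_num) one_pos le_rfl]
      with n hn h
    have h1 := pebblingNumber_pathClique_le (hpos n hn) (hlog n hn)
    have h2 := le_pebblingNumber_twoPathClique (Lp_pos (m := 1000) (by omega) (by norm_num)) h.1
    have h3 := mul_le_two_pow_two_mul_Lp (n := n) (m := 1000) (by omega) (by norm_num)
    have h4 : 2 ^ Nat.log 2 n ≤ n := Nat.pow_log_le_self 2 (by omega)
    rw [Ggraph, Hgraph]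
    omega
  · intro c hc
    have ha : 0 < 1 / (6 * (c + 1)) := by positivity
    have ha1 : 1 / (6 * (c + 1)) ≤ 1 := by
      rw [div_le_one (by positivity)]
      linarith
    filter_upwards [Filter.eventually_ge_atTop 2,
      eventually_half_le_solvableProportion_Hgraph (m := 1000) (by norm_num) ha ha1]
      with n hn h
    have h1 : (n : ℝ) ≤ 6 * tauAlpha n (Ggraph n) (1 / 2) := by
      exact_mod_cast le_six_mul_tauAlpha_pathClique (hpos n hn) (hlog n hn)
        (Nat.lt_pow_succ_log_self (by norm_num) n).le
    have h2 : (tauAlpha n (Hgraph n 1000) (1 / 2) : ℝ) ≤ 1 / (6 * (c + 1)) * n := by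
      refine le_trans ?_ (Nat.floor_le (by positivity))
      exact_mod_cast Nat.sInf_le (s := {t | 1 / 2 ≤ solvableProportion n (Hgraph n 1000) t}) h.2
    have hn0 : (0 : ℝ) < n := by exact_mod_cast (show 0 < n by omega)
    have h3 : c * (1 / (6 * (c + 1)) * n) < n / 6 := by
      rw [show c * (1 / (6 * (c + 1)) * n) = n / 6 * (c / (c + 1)) by field_simp]
      exact mul_lt_of_lt_one_right (by positivity) ((div_lt_one (by positivity)).2 (by linarith))
    have h4 := mul_le_mul_of_nonneg_left h2 hc.le
    linarith
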